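/- arXiv:2305.17009 — 2 statements merged into one kernel-verified Lean document; each statement's English description precedes it below -/
import Mathlib

section
/- Semigroup property of Riemann–Liouville fractional integration (Letnikov): let f : ℝ → ℝ be continuous on [0, ∞) and let α, β > 0 be real. Then for every x > 0, (1/Γ(α)) ∫₀ˣ (x−t)^{α−1} · [(1/Γ(β)) ∫₀ᵗ (t−s)^{β−1} f(s) ds] dt = (1/Γ(α+β)) ∫₀ˣ (x−t)^{α+β−1} f(t) dt; that is, composing the fractional integrals of orders α and β gives the fractional integral of order α+β. -/
open intervalIntegral Real

open MeasureTheory Set in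
lemma rl_ioo (g : ℝ → ℝ) {a b : ℝ} (h : a ≤ b) :
    ∫ t in a..b, g t = ∫ t in Ioo a b, g t := by
  rw [intervalIntegral.integral_of_le h, integral_Ioc_eq_integral_Ioo]

lemma rl_beta0 {α β a : ℝ} (hα : 0 < α) (hβ : 0 < β) (ha : 0 < a) :
    ∫ t in (0:ℝ)..a, t ^ (β - 1) * (a - t) ^ (α - 1) =
      a ^ (α + β - 1) * (Real.Gamma α * Real.Gamma β / Real.Gamma (α + β)) := by
  have h := Complex.betaIntegral_scaled (β : ℂ) (α : ℂ) ha
  rw [Complex.betaIntegral_eq_Gamma_mul_div _ _ (by simpa) (by simpa)] at h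
  rw [← Complex.ofReal_inj]
  rw [← intervalIntegral.integral_ofReal]
  have e : ∫ t in (0:ℝ)..a, (((t ^ (β - 1) * (a - t) ^ (α - 1) : ℝ)) : ℂ) =
      ∫ t in (0:ℝ)..a, (t : ℂ) ^ ((β : ℂ) - 1) * ((a : ℂ) - t) ^ ((α : ℂ) - 1) := by
    apply intervalIntegral.integral_congr
    intro t ht
    rw [Set.uIcc_of_le ha.le] at ht
    simp only
    push_cast [Complex.ofReal_cpow ht.1, Complex.ofReal_cpow (sub_nonneg.2 ht.2)]
    rfl
  rw [e, h]
  push_cast [Complex.ofReal_cpow ha.le, ← Complex.Gamma_ofReal]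
  rw [add_comm (β : ℂ) α, mul_comm (Complex.Gamma β)]

open MeasureTheory Set in
lemma rl_beta {α β s x : ℝ} (hα : 0 < α) (hβ : 0 < β) (hs : s < x) :
    ∫ t in Ioo s x, (x - t) ^ (α - 1) * (t - s) ^ (β - 1) =
      (x - s) ^ (α + β - 1) * (Real.Gamma α * Real.Gamma β / Real.Gamma (α + β)) := by
  rw [← rl_ioo _ hs.le, ← rl_beta0 hα hβ (sub_pos.2 hs)]
  have := intervalIntegral.integral_comp_sub_right
    (fun t => t ^ (β - 1) * (x - s - t) ^ (α - 1)) (a := s) (b := x) s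
  rw [sub_self] at this
  rw [← this]
  congr 1
  ext t
  rw [mul_comm, sub_sub_sub_cancel_right]

open MeasureTheory Set in
lemma rl_beta_int {α β s x : ℝ} (hα : 0 < α) (hβ : 0 < β) (hs : s < x) :
    IntegrableOn (fun t => (x - t) ^ (α - 1) * (t - s) ^ (β - 1)) (Ioo s x) := by
  by_contra h
  have h1 := integral_undef h
  rw [rl_beta hα hβ hs] at h1
  have := Real.Gamma_pos_of_pos hα
  have := Real.Gamma_pos_of_pos hβ
  have := Real.Gamma_pos_of_pos (add_pos hα hβ)
  have := Real.rpow_pos_of_pos (sub_pos.2 hs) (α + β - 1)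
  exact absurd h1 (by positivity)

open MeasureTheory Set in
lemma rl_swap (F : ℝ → ℝ) (hF : Continuous F) (α β : ℝ) (hα : 0 < α) (hβ : 0 < β)
    (x : ℝ) (hx : 0 < x) :
    ∫ t in Ioo 0 x, (x - t) ^ (α - 1) * ∫ s in Ioo 0 t, (t - s) ^ (β - 1) * F s =
      (Real.Gamma α * Real.Gamma β / Real.Gamma (α + β)) *
        ∫ s in Ioo 0 x, (x - s) ^ (α + β - 1) * F s := by
  set B := Real.Gamma α * Real.Gamma β / Real.Gamma (α + β) with hB
  let k : ℝ × ℝ → ℝ := fun p => (x - p.1) ^ (α - 1) * (p.1 - p.2) ^ (β - 1) * F p.2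
  let S : Set (ℝ × ℝ) := {p | p.2 < p.1}
  have hS : MeasurableSet S := measurableSet_lt measurable_snd measurable_fst
  let H : ℝ → ℝ → ℝ := fun t s => S.indicator k (t, s)
  have hk : Measurable k := by
    have := hF.measurable
    fun_prop
  have e1 : ∀ t s, H t s = (Iio t).indicator (fun s => k (t, s)) s := fun t s => by
    simp [H, S, indicator]
  have e2 : ∀ t s, H t s = (Ioi s).indicator (fun t => k (t, s)) t := fun t s => by
    simp [H, S, indicator]
  have i1 : ∀ t ∈ Ioo 0 x, Ioo 0 x ∩ Iio t = Ioo 0 t := fun t ht => by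
    ext s; simp only [mem_inter_iff, mem_Ioo, mem_Iio]
    exact ⟨fun h => ⟨h.1.1, h.2⟩, fun h => ⟨⟨h.1, h.2.trans ht.2⟩, h.2⟩⟩
  have i2 : ∀ s ∈ Ioo 0 x, Ioo 0 x ∩ Ioi s = Ioo s x := fun s hs => by
    ext t; simp only [mem_inter_iff, mem_Ioo, mem_Ioi]
    exact ⟨fun h => ⟨h.2, h.1.2⟩, fun h => ⟨⟨hs.1.trans h.1, h.2⟩, h.1⟩⟩
  have hint : Integrable (Function.uncurry H)
      ((volume.restrict (Ioo 0 x)).prod (volume.restrict (Ioo 0 x))) := by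
    have hm : Measurable (Function.uncurry H) := hk.indicator hS
    rw [integrable_prod_iff' hm.aestronglyMeasurable]
    constructor
    · filter_upwards [ae_restrict_mem measurableSet_Ioo] with s hs
      simp only [Function.uncurry_apply_pair, e2]
      rw [integrable_indicator_iff measurableSet_Ioi, IntegrableOn,
        Measure.restrict_restrict measurableSet_Ioi, inter_comm, i2 s hs]
      exact (rl_beta_int hα hβ hs.2).mul_const (F s)
    · have hg : IntegrableOn (fun s => (x - s) ^ (α + β - 1) * (B * |F s|)) (Ioo 0 x) := by
        have h1 : IntervalIntegrable (fun s : ℝ => (x - s) ^ (α + β - 1)) volume 0 x := by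
          have := (intervalIntegral.intervalIntegrable_rpow' (a := 0) (b := x)
            (r := α + β - 1) (by linarith)).comp_sub_left x
          simpa using this.symm
        have h2 := h1.mul_continuousOn (g := fun s => B * |F s|) (by fun_prop)
        exact ((intervalIntegrable_iff_integrableOn_Ioc_of_le hx.le).1 h2).mono_set
          Ioo_subset_Ioc_self
      refine Integrable.congr hg ?_
      filter_upwards [ae_restrict_mem measurableSet_Ioo] with s hs
      simp only [Function.uncurry_apply_pair, e2, norm_indicator_eq_indicator_norm]
      rw [MeasureTheory.integral_indicator measurableSet_Ioi,
        Measure.restrict_restrict measurableSet_Ioi, inter_comm, i2 s hs]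
      rw [← mul_assoc, ← rl_beta hα hβ hs.2, ← MeasureTheory.integral_mul_const]
      refine setIntegral_congr_fun measurableSet_Ioo fun t ht => ?_
      simp only [k, norm_mul, Real.norm_eq_abs]
      rw [abs_of_nonneg (Real.rpow_nonneg (sub_nonneg.2 ht.2.le) _),
        abs_of_nonneg (Real.rpow_nonneg (sub_nonneg.2 ht.1.le) _)]
  have hsw := integral_integral_swap hint
  have l : ∫ t in Ioo 0 x, (x - t) ^ (α - 1) * ∫ s in Ioo 0 t, (t - s) ^ (β - 1) * F s =
      ∫ t in Ioo 0 x, ∫ s in Ioo 0 x, H t s := by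
    refine setIntegral_congr_fun measurableSet_Ioo fun t ht => ?_
    simp only [e1]
    rw [MeasureTheory.integral_indicator measurableSet_Iio,
        Measure.restrict_restrict measurableSet_Iio, inter_comm, i1 t ht, ← MeasureTheory.integral_const_mul]
    simp only [k, mul_assoc]
  rw [l, hsw, ← MeasureTheory.integral_const_mul]
  refine setIntegral_congr_fun measurableSet_Ioo fun s hs => ?_
  simp only [e2]
  rw [MeasureTheory.integral_indicator measurableSet_Ioi,
        Measure.restrict_restrict measurableSet_Ioi, inter_comm, i2 s hs]
  simp only [k]
  rw [MeasureTheory.integral_mul_const, rl_beta hα hβ hs.2]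
  ring

/-- Semigroup property of Riemann–Liouville fractional integration (Letnikov):
composing fractional integrals of orders `α` and `β` gives the fractional
integral of order `α + β`. -/
theorem rl_fractional_integral_semigroup
    (f : ℝ → ℝ) (hf : ContinuousOn f (Set.Ici (0 : ℝ)))
    (α β : ℝ) (hα : 0 < α) (hβ : 0 < β)
    (x : ℝ) (hx : 0 < x) :
    (1 / Real.Gamma α) *
        ∫ t in (0:ℝ)..x, (x - t) ^ (α - 1) *
          ((1 / Real.Gamma β) * ∫ s in (0:ℝ)..t, (t - s) ^ (β - 1) * f s) =
      (1 / Real.Gamma (α + β)) * ∫ t in (0:ℝ)..x, (x - t) ^ (α + β - 1) * f t := by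
  have hF : Continuous (fun s => f (max s 0)) :=
    hf.comp_continuous (by fun_prop) (fun s => le_max_right s 0)
  have h := rl_swap _ hF α β hα hβ x hx
  have c : ∀ (γ t : ℝ), ∫ s in Set.Ioo 0 t, (t - s) ^ (γ - 1) * f (max s 0) =
      ∫ s in Set.Ioo 0 t, (t - s) ^ (γ - 1) * f s := fun γ t =>
    MeasureTheory.setIntegral_congr_fun measurableSet_Ioo fun s hs => by
      simp only [max_eq_left hs.1.le]
  simp only [c] at h
  have l : ∫ t in (0:ℝ)..x, (x - t) ^ (α - 1) *
          ((1 / Real.Gamma β) * ∫ s in (0:ℝ)..t, (t - s) ^ (β - 1) * f s) =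
      (1 / Real.Gamma β) * ∫ t in Set.Ioo 0 x, (x - t) ^ (α - 1) *
          ∫ s in Set.Ioo 0 t, (t - s) ^ (β - 1) * f s := by
    rw [rl_ioo _ hx.le, ← MeasureTheory.integral_const_mul]
    refine MeasureTheory.setIntegral_congr_fun measurableSet_Ioo fun t ht => ?_
    simp only [rl_ioo _ ht.1.le]
    ring
  rw [l, h, rl_ioo _ hx.le]
  have := (Real.Gamma_pos_of_pos hα).ne'
  have := (Real.Gamma_pos_of_pos hβ).ne'
  have := (Real.Gamma_pos_of_pos (add_pos hα hβ)).ne'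
  field_simp
end

section
/- Uniqueness for the Sturm–Liouville-type boundary value problem of Case 4: if u and v are twice continuously differentiable functions on [0, 1] satisfying u''(x) = 2x·(5 − u(x)) and v''(x) = 2x·(5 − v(x)) for all x ∈ (0, 1), with u(0) = v(0) and u(1) = v(1), then u = v on [0, 1]. (Equivalently, the only C² function w on [0, 1] with w''(x) = −2x·w(x) on (0, 1) and w(0) = w(1) = 0 is w ≡ 0.) -/
theorem case4_smooth (u : ℝ → ℝ) (hu : ContDiffOn ℝ 2 u (Set.Icc 0 1)) :
    ∀ x ∈ Set.Ioo (0 : ℝ) 1, HasDerivAt u (deriv u x) x ∧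
      HasDerivAt (deriv u) (deriv (deriv u) x) x := by
  intro x hx
  have h : ContDiffOn ℝ (1 + 1) u (Set.Ioo 0 1) := by
    have := hu.mono Set.Ioo_subset_Icc_self
    rwa [show (2 : WithTop ℕ∞) = 1 + 1 by norm_num] at this
  rw [contDiffOn_succ_iff_deriv_of_isOpen isOpen_Ioo] at h
  have hn := isOpen_Ioo.mem_nhds hx
  exact ⟨(h.1.differentiableAt hn).hasDerivAt,
    ((h.2.2.differentiableOn one_ne_zero).differentiableAt hn).hasDerivAt⟩

theorem case4_le
    (u v : ℝ → ℝ)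
    (hu : ContDiffOn ℝ 2 u (Set.Icc 0 1)) (hv : ContDiffOn ℝ 2 v (Set.Icc 0 1))
    (hueq : ∀ x ∈ Set.Ioo (0 : ℝ) 1, deriv (deriv u) x = 2 * x * (5 - u x))
    (hveq : ∀ x ∈ Set.Ioo (0 : ℝ) 1, deriv (deriv v) x = 2 * x * (5 - v x))
    (h0 : u 0 = v 0) (h1 : u 1 = v 1) :
    ∀ x ∈ Set.Icc (0 : ℝ) 1, u x ≤ v x := by
  have hφ : ∀ x ∈ Set.Icc (0 : ℝ) 1, 0 < 1 + 2 * x - 2 * x ^ 2 := by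
    intro x hx
    nlinarith [hx.1, hx.2, mul_nonneg hx.1 (sub_nonneg.2 hx.2)]
  have hc : ContinuousOn (fun x => (u x - v x) / (1 + 2 * x - 2 * x ^ 2)) (Set.Icc (0 : ℝ) 1) :=
    (hu.continuousOn.sub hv.continuousOn).div (by fun_prop) (fun x hx => (hφ x hx).ne')
  obtain ⟨c, hcm, hmax⟩ := isCompact_Icc.exists_isMaxOn
    (Set.nonempty_Icc.2 (zero_le_one (α := ℝ))) hc
  obtain ⟨m, hm⟩ : ∃ m, m = (u c - v c) / (1 + 2 * c - 2 * c ^ 2) := ⟨_, rfl⟩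
  have hle : ∀ x ∈ Set.Icc (0 : ℝ) 1, u x - v x ≤ m * (1 + 2 * x - 2 * x ^ 2) := by
    intro x hx
    have := hmax hx
    simp only [Set.mem_ofPred_eq, ← hm] at this
    exact (div_le_iff₀ (hφ x hx)).1 this
  have hceq : u c - v c = m * (1 + 2 * c - 2 * c ^ 2) := by
    rw [hm, div_mul_cancel₀ _ (hφ c hcm).ne']
  by_cases hm0 : m ≤ 0
  · intro x hx
    nlinarith [hle x hx, mul_nonneg (neg_nonneg.2 hm0) (hφ x hx).le]
  exfalso
  push Not at hm0
  have hc0 : c ≠ 0 := by rintro rfl; rw [h0] at hceq; linarith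
  have hc1 : c ≠ 1 := by rintro rfl; rw [h1] at hceq; linarith
  have hcI : c ∈ Set.Ioo (0 : ℝ) 1 :=
    ⟨lt_of_le_of_ne hcm.1 hc0.symm, lt_of_le_of_ne hcm.2 hc1⟩
  have hn := isOpen_Ioo.mem_nhds hcI
  obtain ⟨g, hg⟩ : ∃ g : ℝ → ℝ, g = fun x => u x - v x - m * (1 + 2 * x - 2 * x ^ 2) := ⟨_, rfl⟩
  have hgd : ∀ x ∈ Set.Ioo (0 : ℝ) 1,
      HasDerivAt g (deriv u x - deriv v x - m * (2 - 4 * x)) x := by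
    intro x hx
    have hq : HasDerivAt (fun x : ℝ => m * (1 + 2 * x - 2 * x ^ 2)) (m * (2 - 4 * x)) x := by
      have := ((((hasDerivAt_id x).const_mul 2).const_add 1).sub
        (((hasDerivAt_id x).pow 2).const_mul 2)).const_mul m
      refine HasDerivAt.congr_deriv this ?_
      norm_num [id]
      left; ring
    rw [hg]
    exact ((case4_smooth u hu x hx).1.sub (case4_smooth v hv x hx).1).sub hq
  have hgd2 : HasDerivAt (deriv g) (deriv (deriv u) c - deriv (deriv v) c - m * (-4)) c := by
    have hq : HasDerivAt (fun x : ℝ => m * (2 - 4 * x)) (m * (-4)) c := by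
      have := (((hasDerivAt_id c).const_mul 4).const_sub 2).const_mul m
      refine HasDerivAt.congr_deriv this ?_
      simp
    refine (((case4_smooth u hu c hcI).2.sub (case4_smooth v hv c hcI).2).sub
      hq).congr_of_eventuallyEq ?_
    filter_upwards [hn] with x hx
    exact (hgd x hx).deriv
  have hlmax : IsLocalMax g c := by
    filter_upwards [hn] with x hx
    have := hle x (Set.Ioo_subset_Icc_self hx)
    simp only [hg]; linarith
  have hpos : 0 < deriv (deriv g) c := by
    rw [hgd2.deriv, hueq c hcI, hveq c hcI]
    have e : 2 * c * (5 - u c) - 2 * c * (5 - v c) - m * (-4)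
        = m * (4 - 2 * c * (1 + 2 * c - 2 * c ^ 2)) := by
      linear_combination (-2 * c) * hceq
    rw [e]
    apply mul_pos hm0
    have hb : 1 + 2 * c - 2 * c ^ 2 ≤ 3 / 2 := by nlinarith [sq_nonneg (2 * c - 1)]
    nlinarith [hcI.1, hcI.2, mul_nonneg hcm.1 (sub_nonneg.2 hb)]
  have hlmin : IsLocalMin g c :=
    isLocalMin_of_deriv_deriv_pos hpos hlmax.deriv_eq_zero (hgd c hcI).continuousAt
  have hconst : g =ᶠ[nhds c] fun _ => g c := by
    filter_upwards [hlmax, hlmin] with x h1 h2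
    exact le_antisymm h1 h2
  have := hconst.deriv.deriv_eq
  simp at this
  linarith



/-- Uniqueness for the Sturm–Liouville-type boundary value problem of Case 4:
two `C²` solutions of `u'' = 2x(5 − u)` on `(0,1)` with the same Dirichlet
boundary data agree on `[0,1]`. -/
theorem case4_uniqueness
    (u v : ℝ → ℝ)
    (hu : ContDiffOn ℝ 2 u (Set.Icc 0 1)) (hv : ContDiffOn ℝ 2 v (Set.Icc 0 1))
    (hueq : ∀ x ∈ Set.Ioo (0 : ℝ) 1, deriv (deriv u) x = 2 * x * (5 - u x))
    (hveq : ∀ x ∈ Set.Ioo (0 : ℝ) 1, deriv (deriv v) x = 2 * x * (5 - v x))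
    (h0 : u 0 = v 0) (h1 : u 1 = v 1) :
    ∀ x ∈ Set.Icc (0 : ℝ) 1, u x = v x := by

  intro x hx
  exact le_antisymm (case4_le u v hu hv hueq hveq h0 h1 x hx)
    (case4_le v u hv hu hveq hueq h0.symm h1.symm x hx)
end
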